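/- Let m > n, suppose (ℝ^n, φ) satisfies the CD(0, m) condition (i.e. ∇²φ(v,v) − ⟨∇φ, v⟩²/(m−n) ≥ 0 everywhere), and let u : (0,∞) × ℝ^n → ℝ be a smooth positive solution of the heat equation ∂ₜu = Lu. Then for every t > 0 and every x ∈ ℝ^n, |∇u(t,x)|²/u(t,x)² − ∂ₜu(t,x)/u(t,x) ≤ m/(2t). (Euclidean case of the K = 0 statement in the paper's Theorem 2.1, the Li–Yau differential Harnack inequality for the Witten Laplacian.) -/

import Mathlib

open scoped RealInnerProductSpace

noncomputable section

/-- Hessian of `f` at `x`, evaluated at the pair of vectors `(v, w)`. -/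
def hess (n : ℕ) (f : EuclideanSpace ℝ (Fin n) → ℝ) (x v w : EuclideanSpace ℝ (Fin n)) : ℝ :=
  fderiv ℝ (fun y => fderiv ℝ f y v) x w

/-- Laplacian `Δf = tr ∇²f`. -/
def lap (n : ℕ) (f : EuclideanSpace ℝ (Fin n) → ℝ) (x : EuclideanSpace ℝ (Fin n)) : ℝ :=
  ∑ i : Fin n, hess n f x (EuclideanSpace.single i 1) (EuclideanSpace.single i 1)

/-- Witten Laplacian `Lf = Δf − ⟨∇φ, ∇f⟩`. -/
def witten (n : ℕ) (φ f : EuclideanSpace ℝ (Fin n) → ℝ) (x : EuclideanSpace ℝ (Fin n)) : ℝ :=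
  lap n f x - ⟪gradient φ x, gradient f x⟫

/-- Squared Frobenius norm of the Hessian. -/
def hessNormSq (n : ℕ) (f : EuclideanSpace ℝ (Fin n) → ℝ) (x : EuclideanSpace ℝ (Fin n)) : ℝ :=
  ∑ i : Fin n, ∑ j : Fin n,
    (hess n f x (EuclideanSpace.single i 1) (EuclideanSpace.single j 1)) ^ 2

/-- The `CD(−K, m)` condition on Euclidean space `ℝⁿ`:
`∇²φ(v,v) − ⟨∇φ, v⟩²/(m−n) ≥ −K|v|²` at every point and for every vector. -/
def CDcond (n : ℕ) (φ : EuclideanSpace ℝ (Fin n) → ℝ) (m K : ℝ) : Prop :=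
  ∀ x v : EuclideanSpace ℝ (Fin n),
    hess n φ x v v - ⟪gradient φ x, v⟫ ^ 2 / (m - n) ≥ -K * ‖v‖ ^ 2

open scoped ContDiff
open Filter Topology

section DirectionalDerivative

variable {E : Type*} [NormedAddCommGroup E] [NormedSpace ℝ E]

/-- The derivative of `g` in the constant direction `v`, as a function. -/
def dirDeriv (v : E) (g : E → ℝ) : E → ℝ := fun p => fderiv ℝ g p v

variable {Ω : Set E} {g h : E → ℝ} {v p : E}

theorem dirDeriv_contDiffOn (hΩ : IsOpen Ω) (hg : ContDiffOn ℝ ∞ g Ω) (v : E) :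
    ContDiffOn ℝ ∞ (dirDeriv v g) Ω :=
  (hg.fderiv_of_isOpen hΩ (by simp)).clm_apply contDiffOn_const

theorem ContDiffOn.differentiableAt_of_mem_isOpen (hΩ : IsOpen Ω) (hg : ContDiffOn ℝ ∞ g Ω)
    (hp : p ∈ Ω) : DifferentiableAt ℝ g p :=
  (hg.contDiffAt (hΩ.mem_nhds hp)).differentiableAt (by simp)

theorem dirDeriv_congr (hΩ : IsOpen Ω) (hgh : ∀ p ∈ Ω, g p = h p) (hp : p ∈ Ω) :
    dirDeriv v g p = dirDeriv v h p := by
  have : g =ᶠ[nhds p] h := Filter.eventuallyEq_of_mem (hΩ.mem_nhds hp) hgh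
  simp only [dirDeriv, this.fderiv_eq]

theorem dirDeriv_comm (hΩ : IsOpen Ω) (hg : ContDiffOn ℝ ∞ g Ω) (hp : p ∈ Ω) (v w : E) :
    dirDeriv v (dirDeriv w g) p = dirDeriv w (dirDeriv v g) p := by
  have hd : DifferentiableAt ℝ (fderiv ℝ g) p :=
    ((hg.fderiv_of_isOpen hΩ (m := ∞) (by simp)).contDiffAt (hΩ.mem_nhds hp)).differentiableAt
      (by simp)
  have key : ∀ a b : E, dirDeriv a (dirDeriv b g) p = fderiv ℝ (fderiv ℝ g) p a b := by
    intro a b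
    have := (hd.hasFDerivAt.clm_apply (hasFDerivAt_const b p)).fderiv
    change fderiv ℝ (fun y => fderiv ℝ g y b) p a = _
    rw [this]
    simp
  rw [key, key]
  have hs : IsSymmSndFDerivAt ℝ g p :=
    (hg.contDiffAt (hΩ.mem_nhds hp)).isSymmSndFDerivAt (by simpa using ENat.LEInfty.out)
  exact hs v w

theorem dirDeriv_add (hg : DifferentiableAt ℝ g p) (hh : DifferentiableAt ℝ h p) :
    dirDeriv v (fun q => g q + h q) p = dirDeriv v g p + dirDeriv v h p := by
  simp [dirDeriv, fderiv_fun_add hg hh]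

theorem dirDeriv_sub (hg : DifferentiableAt ℝ g p) (hh : DifferentiableAt ℝ h p) :
    dirDeriv v (fun q => g q - h q) p = dirDeriv v g p - dirDeriv v h p := by
  simp [dirDeriv, fderiv_fun_sub hg hh]

theorem dirDeriv_const_mul (hg : DifferentiableAt ℝ g p) (c : ℝ) :
    dirDeriv v (fun q => c * g q) p = c * dirDeriv v g p := by
  simp [dirDeriv, fderiv_const_mul hg c]

theorem dirDeriv_mul (hg : DifferentiableAt ℝ g p) (hh : DifferentiableAt ℝ h p) :
    dirDeriv v (fun q => g q * h q) p = g p * dirDeriv v h p + h p * dirDeriv v g p := by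
  simp [dirDeriv, fderiv_fun_mul hg hh]

theorem dirDeriv_sq (hg : DifferentiableAt ℝ g p) :
    dirDeriv v (fun q => g q ^ 2) p = 2 * g p * dirDeriv v g p := by
  simp [dirDeriv, fderiv_fun_pow 2 hg]

theorem dirDeriv_sum {ι : Type*} {s : Finset ι} {G : ι → E → ℝ}
    (hG : ∀ i ∈ s, DifferentiableAt ℝ (G i) p) :
    dirDeriv v (fun q => ∑ i ∈ s, G i q) p = ∑ i ∈ s, dirDeriv v (G i) p := by
  simp [dirDeriv, fderiv_fun_sum hG]

theorem hasDerivAt_dirDeriv_line (s : ℝ) (hg : DifferentiableAt ℝ g (p + s • v)) :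
    HasDerivAt (fun r : ℝ => g (p + r • v)) (dirDeriv v g (p + s • v)) s := by
  have hl : HasDerivAt (fun r : ℝ => p + r • v) v s := by
    simpa using ((hasDerivAt_id s).smul_const v).const_add p
  exact hg.hasFDerivAt.comp_hasDerivAt s hl

/-- The Li–Yau quantity `|∇f|² - α ∂ₜf`. -/
def liYau {ι : Type*} [Fintype ι] (e : ι → E) (τ : E) (α : ℝ) (f : E → ℝ) : E → ℝ :=
  fun p => ∑ j, (dirDeriv (e j) f p) ^ 2 - α * dirDeriv τ f p

section Bochner
variable {ι : Type*} [Fintype ι] {e : ι → E} {τ : E} {f : E → ℝ}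

theorem liYau_contDiffOn (hΩ : IsOpen Ω) (hf : ContDiffOn ℝ ∞ f Ω) (α : ℝ) :
    ContDiffOn ℝ ∞ (liYau e τ α f) Ω :=
  (ContDiffOn.sum fun j _ => (dirDeriv_contDiffOn hΩ hf (e j)).pow 2).sub
    (contDiffOn_const.mul (dirDeriv_contDiffOn hΩ hf τ))

theorem dirDeriv_liYau (hΩ : IsOpen Ω) (hf : ContDiffOn ℝ ∞ f Ω) (α : ℝ) (hp : p ∈ Ω) (v : E) :
    dirDeriv v (liYau e τ α f) p =
      ∑ j, 2 * (dirDeriv (e j) f p * dirDeriv v (dirDeriv (e j) f) p)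
        - α * dirDeriv v (dirDeriv τ f) p := by
  have hd : ∀ w, DifferentiableAt ℝ (dirDeriv w f) p := fun w =>
    (dirDeriv_contDiffOn hΩ hf w).differentiableAt_of_mem_isOpen hΩ hp
  unfold liYau
  rw [dirDeriv_sub (DifferentiableAt.fun_sum fun j _ => (hd (e j)).fun_pow 2) ((hd τ).const_mul α),
    dirDeriv_sum fun j _ => (hd (e j)).fun_pow 2, dirDeriv_const_mul (hd τ)]
  congr 1
  refine Finset.sum_congr rfl fun j _ => ?_
  rw [dirDeriv_sq (hd _), mul_assoc]

theorem dirDeriv_dirDeriv_liYau (hΩ : IsOpen Ω) (hf : ContDiffOn ℝ ∞ f Ω) (α : ℝ) (hp : p ∈ Ω)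
    (v : E) :
    dirDeriv v (dirDeriv v (liYau e τ α f)) p =
      ∑ j, 2 * (dirDeriv (e j) f p * dirDeriv v (dirDeriv v (dirDeriv (e j) f)) p
          + dirDeriv v (dirDeriv (e j) f) p ^ 2)
        - α * dirDeriv v (dirDeriv v (dirDeriv τ f)) p := by
  have hd : ∀ w, DifferentiableAt ℝ (dirDeriv w f) p := fun w =>
    (dirDeriv_contDiffOn hΩ hf w).differentiableAt_of_mem_isOpen hΩ hp
  have hd2 : ∀ w, DifferentiableAt ℝ (dirDeriv v (dirDeriv w f)) p := fun w =>
    (dirDeriv_contDiffOn hΩ (dirDeriv_contDiffOn hΩ hf w) v).differentiableAt_of_mem_isOpen hΩ hp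
  rw [dirDeriv_congr hΩ (fun q hq => dirDeriv_liYau hΩ hf α hq v) hp,
    dirDeriv_sub (DifferentiableAt.fun_sum fun j _ => ((hd (e j)).fun_mul (hd2 (e j))).const_mul 2)
      ((hd2 τ).const_mul α),
    dirDeriv_sum fun j _ => ((hd (e j)).fun_mul (hd2 (e j))).const_mul 2, dirDeriv_const_mul (hd2 τ)]
  congr 1
  refine Finset.sum_congr rfl fun j _ => ?_
  rw [dirDeriv_const_mul ((hd (e j)).fun_mul (hd2 (e j))), dirDeriv_mul (hd _) (hd2 _)]
  ring

/-- Differentiating the equation `∂ₜf = Δf + |∇f|²` in a constant direction. -/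
theorem dirDeriv_logHeat (hΩ : IsOpen Ω) (hf : ContDiffOn ℝ ∞ f Ω)
    (heq : ∀ p ∈ Ω, dirDeriv τ f p =
      ∑ i, dirDeriv (e i) (dirDeriv (e i) f) p + ∑ i, dirDeriv (e i) f p ^ 2)
    (hp : p ∈ Ω) (v : E) :
    dirDeriv τ (dirDeriv v f) p = ∑ i, dirDeriv (e i) (dirDeriv (e i) (dirDeriv v f)) p
      + ∑ i, 2 * (dirDeriv (e i) f p * dirDeriv (e i) (dirDeriv v f) p) := by
  have hd : ∀ w, DifferentiableAt ℝ (dirDeriv w f) p := fun w =>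
    (dirDeriv_contDiffOn hΩ hf w).differentiableAt_of_mem_isOpen hΩ hp
  have hs2 : ∀ w w', ContDiffOn ℝ ∞ (dirDeriv w (dirDeriv w' f)) Ω := fun w w' =>
    dirDeriv_contDiffOn hΩ (dirDeriv_contDiffOn hΩ hf w') w
  have hd2 : ∀ w w', DifferentiableAt ℝ (dirDeriv w (dirDeriv w' f)) p := fun w w' =>
    (hs2 w w').differentiableAt_of_mem_isOpen hΩ hp
  rw [dirDeriv_comm hΩ hf hp, dirDeriv_congr hΩ heq hp,
    dirDeriv_add (DifferentiableAt.fun_sum fun i _ => hd2 _ _)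
      (DifferentiableAt.fun_sum fun i _ => (hd _).fun_pow 2),
    dirDeriv_sum fun i _ => hd2 _ _, dirDeriv_sum fun i _ => (hd _).fun_pow 2]
  congr 1
  · refine Finset.sum_congr rfl fun i _ => ?_
    rw [dirDeriv_comm hΩ (dirDeriv_contDiffOn hΩ hf (e i)) hp]
    exact dirDeriv_congr hΩ (fun q hq => dirDeriv_comm hΩ hf hq _ _) hp
  · refine Finset.sum_congr rfl fun i _ => ?_
    rw [dirDeriv_sq (hd _), dirDeriv_comm hΩ hf hp, mul_assoc]

/-- Bochner's formula for the Li–Yau quantity along `∂ₜf = Δf + |∇f|²`. -/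
theorem liYau_bochner (hΩ : IsOpen Ω) (hf : ContDiffOn ℝ ∞ f Ω)
    (heq : ∀ p ∈ Ω, dirDeriv τ f p =
      ∑ i, dirDeriv (e i) (dirDeriv (e i) f) p + ∑ i, dirDeriv (e i) f p ^ 2)
    (α : ℝ) (hp : p ∈ Ω) :
    dirDeriv τ (liYau e τ α f) p =
      ∑ i, dirDeriv (e i) (dirDeriv (e i) (liYau e τ α f)) p
      + ∑ i, 2 * (dirDeriv (e i) f p * dirDeriv (e i) (liYau e τ α f) p)
      - 2 * ∑ i, ∑ j, dirDeriv (e i) (dirDeriv (e j) f) p ^ 2 := by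
  have h1 := dirDeriv_logHeat hΩ hf heq hp
  rw [dirDeriv_liYau hΩ hf α hp]
  simp only [dirDeriv_dirDeriv_liYau hΩ hf α hp, h1, dirDeriv_liYau hΩ hf α hp]
  simp only [Finset.sum_sub_distrib, mul_sub, mul_add, Finset.sum_add_distrib, Finset.mul_sum]
  rw [Finset.sum_comm (f := fun i j => 2 * (dirDeriv (e i) f p * (2 * _))),
    Finset.sum_comm (f := fun j i => 2 * (dirDeriv (e j) f p * dirDeriv (e i) _ p))]
  have e1 : ∀ i, 2 * (dirDeriv (e i) f p * (α * dirDeriv (e i) (dirDeriv τ f) p))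
    = α * (2 * (dirDeriv (e i) f p * dirDeriv (e i) (dirDeriv τ f) p)) := fun i => by ring
  have e2 : ∀ i j, 2 * (dirDeriv (e i) f p *
      (2 * (dirDeriv (e j) f p * dirDeriv (e i) (dirDeriv (e j) f) p)))
    = 2 * (dirDeriv (e j) f p * (2 * (dirDeriv (e i) f p * dirDeriv (e i) (dirDeriv (e j) f) p))) :=
    fun i j => by ring
  simp only [e1, e2]
  ring

/-- Cauchy–Schwarz for the trace: the square of the Laplacian is at most `n |∇²f|²`. -/
theorem sq_sum_dirDeriv_le :
    (∑ i, dirDeriv (e i) (dirDeriv (e i) f) p) ^ 2 ≤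
      Fintype.card ι * ∑ i, ∑ j, dirDeriv (e i) (dirDeriv (e j) f) p ^ 2 := by
  refine (sq_sum_le_card_mul_sum_sq (s := Finset.univ)).trans ?_
  rw [Finset.card_univ]
  gcongr with i _
  exact Finset.single_le_sum (f := fun j => dirDeriv (e i) (dirDeriv (e j) f) p ^ 2)
    (fun j _ => sq_nonneg _) (Finset.mem_univ i)

end Bochner

end DirectionalDerivative

/-- Second derivative test at a local maximum. -/
theorem IsLocalMax.eq_zero_and_nonpos_of_hasDerivAt {q q' : ℝ → ℝ} {c x : ℝ} (hq : IsLocalMax q x)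
    (h1 : ∀ᶠ s in 𝓝 x, HasDerivAt q (q' s) s) (h2 : HasDerivAt q' c x) : q' x = 0 ∧ c ≤ 0 := by
  have h0 : q' x = 0 := hq.hasDerivAt_eq_zero h1.self_of_nhds
  refine ⟨h0, ?_⟩
  by_contra! hc
  have hd : deriv q =ᶠ[𝓝 x] q' := h1.mono fun s hs => hs.deriv
  have hdd : deriv (deriv q) x = c := by rw [hd.deriv_eq, h2.deriv]
  have hmin : IsLocalMin q x := isLocalMin_of_deriv_deriv_pos (by rw [hdd]; exact hc)
    (by rw [hd.self_of_nhds, h0]) h1.self_of_nhds.continuousAt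
  have hconst : q =ᶠ[𝓝 x] fun _ => q x := by
    filter_upwards [hq, hmin] with s hs hs' using le_antisymm hs hs'
  have : deriv q =ᶠ[𝓝 x] fun _ => 0 := by
    filter_upwards [hconst.deriv] with s hs
    rw [hs]; simp
  rw [this.deriv_eq] at hdd
  simp at hdd
  exact hc.ne hdd

theorem HasDerivAt.nonneg_of_eventually_left_le {q : ℝ → ℝ} {c x : ℝ} (hq : HasDerivAt q c x)
    (hmax : ∀ᶠ s in 𝓝[<] x, q s ≤ q x) : 0 ≤ c := by
  have ht : Tendsto (slope q x) (𝓝[<] x) (𝓝 c) :=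
    hq.tendsto_slope.mono_left (nhdsWithin_mono _ fun s hs => ne_of_lt hs)
  refine ge_of_tendsto ht ?_
  filter_upwards [hmax, self_mem_nhdsWithin] with s hs hsx
  rw [slope_def_field]
  exact div_nonneg_of_nonpos (by linarith) (by have : s < x := hsx; linarith)

/-- A function on `ℝ` with antitone derivative that is bounded below has zero derivative. -/
theorem eq_zero_of_antitone_deriv_of_pos {w w' : ℝ → ℝ} (hw : ∀ s, HasDerivAt w (w' s) s)
    (hanti : Antitone w') (hpos : ∀ s, 0 < w s) (a : ℝ) : w' a = 0 := by
  have hc : Continuous w := continuous_iff_continuousAt.2 fun s => (hw s).continuousAt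
  by_contra hne
  rcases lt_or_gt_of_ne hne with h | h
  · have hab : a < a - w a / w' a := by
      have := div_neg_of_pos_of_neg (hpos a) h
      linarith
    obtain ⟨s, hs, hs'⟩ := exists_hasDerivAt_eq_slope w w' hab hc.continuousOn fun s _ => hw s
    have h1 := hanti hs.1.le
    rw [hs', div_le_iff₀ (by linarith)] at h1
    have h2 : w' a * (a - w a / w' a - a) = - w a := by field_simp; ring
    linarith [hpos (a - w a / w' a)]
  · have hab : a - w a / w' a < a := by
      have := div_pos (hpos a) h
      linarith
    obtain ⟨s, hs, hs'⟩ := exists_hasDerivAt_eq_slope w w' hab hc.continuousOn fun s _ => hw s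
    have h1 := hanti hs.2.le
    rw [hs', le_div_iff₀ (by linarith)] at h1
    have h2 : w' a * (a - (a - w a / w' a)) = w a := by field_simp; ring
    linarith [hpos (a - w a / w' a)]

/-- The Riccati inequality `y' ≥ y² / k` has no nonzero entire solution. -/
theorem eq_zero_of_riccati_le {h y y' : ℝ → ℝ} {k : ℝ} (hk : 0 < k)
    (hh : ∀ s, HasDerivAt h (y s) s) (hy : ∀ s, HasDerivAt y (y' s) s)
    (hric : ∀ s, y s ^ 2 / k ≤ y' s) (a : ℝ) : y a = 0 := by
  have hw : ∀ s, HasDerivAt (fun r => Real.exp (-(h r) / k))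
      (Real.exp (-(h s) / k) * (-(y s) / k)) s := fun s => ((hh s).neg.div_const k).exp
  have hw' : ∀ s, HasDerivAt (fun r => Real.exp (-(h r) / k) * (-(y r) / k))
      (Real.exp (-(h s) / k) * (-(y s) / k) * (-(y s) / k)
        + Real.exp (-(h s) / k) * (-(y' s) / k)) s :=
    fun s => (hw s).mul ((hy s).neg.div_const k)
  have hanti : Antitone fun r => Real.exp (-(h r) / k) * (-(y r) / k) := by
    refine antitone_of_hasDerivAt_nonpos hw' fun s => ?_
    have e : Real.exp (-(h s) / k) * (-(y s) / k) * (-(y s) / k)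
        + Real.exp (-(h s) / k) * (-(y' s) / k)
        = -(Real.exp (-(h s) / k) / k * (y' s - y s ^ 2 / k)) := by
      field_simp; ring
    rw [e]
    have := mul_nonneg (div_pos (Real.exp_pos (-(h s) / k)) hk).le (sub_nonneg.2 (hric s))
    simpa using this
  have := eq_zero_of_antitone_deriv_of_pos hw hanti (fun s => Real.exp_pos _) a
  simpa [hk.ne', Real.exp_ne_zero] using this

/-- The pointwise estimate which rules out a positive interior maximum of `H - B`,
where `B = c / s + A R² / (R² - |z|²)²` is the barrier. -/
theorem liYau_barrier_absurd {ι : Type*} [Fintype ι] {α c s A R D H Ht L S : ℝ}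
    {a z P Q : ι → ℝ} (hα : 1 < α) (hc : 0 < c) (hcα : 2 * c = Fintype.card ι * α ^ 2)
    (hs : 0 < s) (hR : 0 < R)
    (hA : A = c * (4 * Fintype.card ι + 24 + 8 * c / (α - 1)))
    (hD : D = R ^ 2 - ∑ i, z i ^ 2) (hD0 : 0 < D)
    (hH : H = ∑ i, a i ^ 2 - α * (L + ∑ i, a i ^ 2))
    (hHB : c / s + A * R ^ 2 / D ^ 2 < H)
    (hHt : -(c / s ^ 2) ≤ Ht)
    (hP : ∀ i, P i = 4 * (A * R ^ 2) * z i / D ^ 3)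
    (hQ : ∀ i, Q i ≤ 4 * (A * R ^ 2) / D ^ 3 + 24 * (A * R ^ 2) * z i ^ 2 / D ^ 4)
    (hbochner : Ht = ∑ i, Q i + ∑ i, 2 * (a i * P i) - 2 * S)
    (hLS : L ^ 2 ≤ Fintype.card ι * S) : False := by
  set N := (Fintype.card ι : ℝ) with hN
  set p := ∑ i, a i ^ 2 with hp
  set r2 := ∑ i, z i ^ 2 with hr2
  have hp0 : 0 ≤ p := Finset.sum_nonneg fun i _ => sq_nonneg _
  have hr0 : 0 ≤ r2 := Finset.sum_nonneg fun i _ => sq_nonneg _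
  have hN0 : 0 ≤ N := Nat.cast_nonneg _
  have hα1 : 0 < α - 1 := by linarith
  have hA0 : 0 < A := by rw [hA]; positivity
  set ψ := A * R ^ 2 / D ^ 2 with hψ
  have hψ0 : 0 < ψ := by positivity
  have hAψ : A * R ^ 2 = ψ * D ^ 2 := by rw [hψ]; field_simp
  have hPa : ∀ i, 2 * (a i * P i) ≤
      2 * (α - 1) * ψ / c * a i ^ 2 + 8 * ψ * c / ((α - 1) * D ^ 2) * z i ^ 2 := by
    intro i
    have : 2 * (α - 1) * ψ / c * a i ^ 2 + 8 * ψ * c / ((α - 1) * D ^ 2) * z i ^ 2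
        - 2 * (a i * P i)
        = 2 * ψ / (c * (α - 1) * D ^ 2) * ((α - 1) * D * a i - 2 * c * z i) ^ 2 := by
      rw [hP, hAψ]; field_simp; ring
    have h2 : 0 ≤ 2 * ψ / (c * (α - 1) * D ^ 2) * ((α - 1) * D * a i - 2 * c * z i) ^ 2 := by
      positivity
    linarith
  have hsumP : ∑ i, 2 * (a i * P i) ≤
      2 * (α - 1) * ψ / c * p + 8 * ψ * c / ((α - 1) * D ^ 2) * r2 :=
    (Finset.sum_le_sum fun i _ => hPa i).trans_eq (by
      rw [Finset.sum_add_distrib, ← Finset.mul_sum, ← Finset.mul_sum])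
  have hQ' : ∀ i, Q i ≤ 4 * ψ / D + 24 * ψ / D ^ 2 * z i ^ 2 := by
    intro i
    refine (hQ i).trans_eq ?_
    rw [hAψ]; field_simp
  have hsumQ : ∑ i, Q i ≤ N * (4 * ψ / D) + 24 * ψ / D ^ 2 * r2 :=
    (Finset.sum_le_sum fun i _ => hQ' i).trans_eq (by
      rw [Finset.sum_add_distrib, ← Finset.mul_sum, Finset.sum_const, Finset.card_univ,
        nsmul_eq_mul])
  have hS : (H + (α - 1) * p) ^ 2 / c ≤ 2 * S := by
    have e : H + (α - 1) * p = -(α * L) := by rw [hH]; ring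
    rw [e, div_le_iff₀ hc]
    nlinarith [mul_le_mul_of_nonneg_left hLS (sq_nonneg α)]
  have hsq : (c / s) ^ 2 + ψ ^ 2 + 2 * ψ * ((α - 1) * p) < (H + (α - 1) * p) ^ 2 := by
    have h1 : 0 < c / s := by positivity
    have h2 : 0 ≤ (α - 1) * p := by positivity
    nlinarith [mul_pos h1 hψ0, mul_nonneg h1.le h2]
  have hsq' : ((c / s) ^ 2 + ψ ^ 2 + 2 * ψ * ((α - 1) * p)) / c < (H + (α - 1) * p) ^ 2 / c :=
    div_lt_div_of_pos_right hsq hc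
  have hsplit : ((c / s) ^ 2 + ψ ^ 2 + 2 * ψ * ((α - 1) * p)) / c
      = c / s ^ 2 + ψ ^ 2 / c + 2 * (α - 1) * ψ / c * p := by field_simp
  have hrest : N * (4 * ψ / D) + 24 * ψ / D ^ 2 * r2 + 8 * ψ * c / ((α - 1) * D ^ 2) * r2
      ≤ ψ ^ 2 / c := by
    have hψ2 : ψ ^ 2 / c = ψ / D ^ 2 * ((4 * N + 24 + 8 * c / (α - 1)) * R ^ 2) := by
      rw [sq, mul_div_assoc]
      have hψc : ψ / c = (4 * N + 24 + 8 * c / (α - 1)) * R ^ 2 / D ^ 2 := by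
        rw [hψ, hA]; field_simp
      rw [hψc]; ring
    have e : N * (4 * ψ / D) + 24 * ψ / D ^ 2 * r2 + 8 * ψ * c / ((α - 1) * D ^ 2) * r2
        = ψ / D ^ 2 * (4 * N * D + 24 * r2 + 8 * c / (α - 1) * r2) := by
      field_simp
    rw [hψ2, e, add_mul, add_mul]
    have : D ≤ R ^ 2 := by linarith
    have : r2 ≤ R ^ 2 := by linarith
    gcongr
  linarith

theorem hasDerivAt_barrier (C d b : ℝ) {s : ℝ} (hs : d - 2 * s * b - s ^ 2 ≠ 0) :
    HasDerivAt (fun r : ℝ => C / (d - 2 * r * b - r ^ 2) ^ 2)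
      (4 * C * (b + s) / (d - 2 * s * b - s ^ 2) ^ 3) s := by
  have hq : HasDerivAt (fun r : ℝ => d - 2 * r * b - r ^ 2) (-(2 * b) - 2 * s) s := by
    have h1 := ((((hasDerivAt_id s).const_mul 2).mul_const b).const_sub d).sub
      ((hasDerivAt_id s).pow 2)
    refine h1.congr_deriv ?_
    simp
  refine ((hasDerivAt_const s C).div (hq.pow 2) (pow_ne_zero 2 hs)).congr_deriv ?_
  simp only [Pi.pow_apply]
  field_simp
  ring

theorem hasDerivAt_deriv_barrier (C b : ℝ) {d : ℝ} (hd : d ≠ 0) :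
    HasDerivAt (fun r : ℝ => 4 * C * (b + r) / (d - 2 * r * b - r ^ 2) ^ 3)
      (4 * C / d ^ 3 + 24 * C * b ^ 2 / d ^ 4) 0 := by
  have hq : HasDerivAt (fun r : ℝ => d - 2 * r * b - r ^ 2) (-(2 * b)) 0 := by
    have h1 := ((((hasDerivAt_id (0 : ℝ)).const_mul 2).mul_const b).const_sub d).sub
      ((hasDerivAt_id (0 : ℝ)).pow 2)
    refine h1.congr_deriv ?_
    simp
  have hn : HasDerivAt (fun r : ℝ => 4 * C * (b + r)) (4 * C) 0 :=
    (((hasDerivAt_id (0 : ℝ)).const_add b).const_mul (4 * C)).congr_deriv (by simp)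
  refine (hn.div (hq.pow 3) (by simpa using hd)).congr_deriv ?_
  simp
  field_simp
  ring

/-- The coordinate direction `eᵢ` in space-time. -/
abbrev spaceDir {n : ℕ} (i : Fin n) : ℝ × EuclideanSpace ℝ (Fin n) :=
  (0, EuclideanSpace.single i 1)

/-- The time direction in space-time. -/
abbrev timeDir (n : ℕ) : ℝ × EuclideanSpace ℝ (Fin n) := (1, 0)

theorem isOpen_positiveTime (V : Type*) [TopologicalSpace V] : IsOpen {p : ℝ × V | 0 < p.1} :=
  isOpen_lt continuous_const continuous_fst

theorem norm_add_smul_single_sub_sq {n : ℕ} (y x : EuclideanSpace ℝ (Fin n)) (i : Fin n) (s : ℝ) :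
    ‖y + s • EuclideanSpace.single i (1 : ℝ) - x‖ ^ 2
      = ‖y - x‖ ^ 2 + 2 * s * (y i - x i) + s ^ 2 := by
  have : y + s • EuclideanSpace.single i (1 : ℝ) - x
    = (y - x) + s • EuclideanSpace.single i (1 : ℝ) := by abel
  rw [this, norm_add_sq_real, inner_smul_right, norm_smul, EuclideanSpace.inner_single_right]
  simp
  ring

/-- Localised Li–Yau estimate on a ball of radius `R`, with initial time `t₀`. -/
theorem liYau_local {n : ℕ} (hn : 1 ≤ n) {f : ℝ × EuclideanSpace ℝ (Fin n) → ℝ}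
    (hf : ContDiffOn ℝ ∞ f {p | 0 < p.1})
    (heq : ∀ p ∈ {p : ℝ × EuclideanSpace ℝ (Fin n) | 0 < p.1}, dirDeriv (timeDir n) f p =
      ∑ i, dirDeriv (spaceDir i) (dirDeriv (spaceDir i) f) p + ∑ i, dirDeriv (spaceDir i) f p ^ 2)
    {α c A : ℝ} (hα : 1 < α) (hcα : 2 * c = n * α ^ 2)
    (hA : A = c * (4 * n + 24 + 8 * c / (α - 1)))
    {t₀ t R : ℝ} (ht₀ : 0 < t₀) (ht : t₀ < t) (hR : 0 < R) (x : EuclideanSpace ℝ (Fin n)) :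
    liYau spaceDir (timeDir n) α f (t, x) ≤ c / (t - t₀) + A / R ^ 2 := by
  by_contra! hcon
  have hΩ := isOpen_positiveTime (EuclideanSpace ℝ (Fin n))
  set H := liYau spaceDir (timeDir n) α f with hHdef
  have hHs : ContDiffOn ℝ ∞ H {p | 0 < p.1} := liYau_contDiffOn hΩ hf α
  have hn0 : (0 : ℝ) < n := by exact_mod_cast hn
  have hc : 0 < c := by nlinarith [mul_pos hn0 (pow_pos (zero_lt_one.trans hα) 2)]
  have hα1 : 0 < α - 1 := by linarith
  have hA0 : 0 < A := by rw [hA]; positivity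
  -- the compact cylinder and a bound for `H` on it
  set K₀ : Set (ℝ × EuclideanSpace ℝ (Fin n)) :=
    Set.Icc t₀ t ×ˢ Metric.closedBall x R
  have hK₀c : IsCompact K₀ := isCompact_Icc.prod (isCompact_closedBall x R)
  have hK₀Ω : K₀ ⊆ {p | 0 < p.1} := fun p hp => ht₀.trans_le hp.1.1
  obtain ⟨M₀, hM₀⟩ := hK₀c.bddAbove_image (hHs.continuousOn.mono hK₀Ω)
  obtain ⟨M, hMpos, hM⟩ : ∃ M : ℝ, 0 < M ∧ ∀ p ∈ K₀, H p ≤ M :=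
    ⟨max M₀ 1, by positivity,
      fun p hp => (hM₀ (Set.mem_image_of_mem H hp)).trans (le_max_left _ _)⟩
  obtain ⟨δ, hδ0, hδt, hδM⟩ : ∃ δ : ℝ, 0 < δ ∧ δ ≤ t - t₀ ∧ M ≤ c / δ := by
    refine ⟨min (t - t₀) (c / M), lt_min (by linarith) (by positivity), min_le_left _ _, ?_⟩
    rw [le_div_iff₀ (lt_min (by linarith) (by positivity))]
    have := mul_le_mul_of_nonneg_left (min_le_right (t - t₀) (c / M)) hMpos.le
    rwa [mul_div_cancel₀ _ hMpos.ne'] at this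
  obtain ⟨ε, hε0, hεR, hεM⟩ : ∃ ε : ℝ, 0 < ε ∧ ε ≤ R ^ 2 ∧ M ≤ A * R ^ 2 / ε ^ 2 := by
    have h1 : 0 < min (R ^ 2) (min 1 (A * R ^ 2 / M)) := by positivity
    refine ⟨_, h1, min_le_left _ _, ?_⟩
    rw [le_div_iff₀ (by positivity)]
    set ε := min (R ^ 2) (min 1 (A * R ^ 2 / M))
    have h2 : ε ≤ 1 := (min_le_right _ _).trans (min_le_left _ _)
    have h3 : ε ≤ A * R ^ 2 / M := (min_le_right _ _).trans (min_le_right _ _)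
    rw [le_div_iff₀ hMpos] at h3
    nlinarith [mul_le_mul_of_nonneg_left h2 h1.le]
  set K : Set (ℝ × EuclideanSpace ℝ (Fin n)) :=
    K₀ ∩ {p | t₀ + δ ≤ p.1 ∧ ‖p.2 - x‖ ^ 2 ≤ R ^ 2 - ε}
  have hKc : IsCompact K := hK₀c.inter_right
    ((isClosed_le continuous_const continuous_fst).inter
      (isClosed_le ((continuous_snd.sub continuous_const).norm.pow 2) continuous_const))
  set B : ℝ × EuclideanSpace ℝ (Fin n) → ℝ :=
    fun p => c / (p.1 - t₀) + A * R ^ 2 / (R ^ 2 - ‖p.2 - x‖ ^ 2) ^ 2 with hB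
  have hBc : ContinuousOn B K := by
    refine ContinuousOn.add (continuousOn_const.div (by fun_prop) ?_)
      (continuousOn_const.div (by fun_prop) ?_)
    · intro p hp; have := hp.2.1; linarith
    · intro p hp; have := hp.2.2; exact pow_ne_zero 2 (by linarith)
  have hxK : (t, x) ∈ K := by
    refine ⟨⟨⟨ht.le, le_rfl⟩, by simpa using hR.le⟩, by simp; linarith, ?_⟩
    simpa using hεR
  obtain ⟨⟨t₁, y⟩, hqK, hmax⟩ := hKc.exists_isMaxOn ⟨_, hxK⟩
    ((hHs.continuousOn.mono (Set.inter_subset_left.trans hK₀Ω)).sub hBc)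
  have hHB : B (t₁, y) < H (t₁, y) := by
    have h1 : H (t, x) - B (t, x) ≤ H (t₁, y) - B (t₁, y) := hmax hxK
    have h2 : B (t, x) = c / (t - t₀) + A / R ^ 2 := by
      simp only [hB, sub_self, norm_zero]
      field_simp
      ring
    linarith
  obtain ⟨⟨⟨ht₁0, ht₁t⟩, hyR⟩, ht₁δ, hyε⟩ := hqK
  simp only at ht₁0 ht₁t hyR ht₁δ hyε
  have hqΩ : (t₁, y) ∈ {p : ℝ × EuclideanSpace ℝ (Fin n) | 0 < p.1} := ht₀.trans_le ht₁0
  have hHM : H (t₁, y) ≤ M := hM _ ⟨⟨ht₁0, ht₁t⟩, hyR⟩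
  have hs0 : 0 < t₁ - t₀ := by linarith
  have hD0 : 0 < R ^ 2 - ‖y - x‖ ^ 2 := by linarith
  simp only [hB] at hHB
  have hs1 : t₀ + δ < t₁ := by
    refine lt_of_le_of_ne ht₁δ fun h => ?_
    rw [show t₁ - t₀ = δ by linarith] at hHB
    have : 0 < A * R ^ 2 / (R ^ 2 - ‖y - x‖ ^ 2) ^ 2 := by positivity
    linarith
  have hD1 : ‖y - x‖ ^ 2 < R ^ 2 - ε := by
    refine lt_of_le_of_ne hyε fun h => ?_
    rw [h, sub_sub_cancel] at hHB
    have : 0 < c / (t₁ - t₀) := by positivity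
    linarith
  -- the time derivative at the maximum
  have hd : ∀ q ∈ {p : ℝ × EuclideanSpace ℝ (Fin n) | 0 < p.1}, DifferentiableAt ℝ H q :=
    fun q hq => hHs.differentiableAt_of_mem_isOpen hΩ hq
  have hHt : -(c / (t₁ - t₀) ^ 2) ≤ dirDeriv (timeDir n) H (t₁, y) := by
    have h1 : HasDerivAt (fun r : ℝ => H (r, y)) (dirDeriv (timeDir n) H (t₁, y)) t₁ := by
      have hl : HasDerivAt (fun r : ℝ => (r, y)) (timeDir n) t₁ :=
        (hasDerivAt_id t₁).prodMk (hasDerivAt_const t₁ y)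
      exact (hd _ hqΩ).hasFDerivAt.comp_hasDerivAt t₁ hl
    have h2 : HasDerivAt (fun r : ℝ => B (r, y)) (-(c / (t₁ - t₀) ^ 2)) t₁ := by
      have h3 : HasDerivAt (fun r : ℝ => c / (r - t₀)) (-(c / (t₁ - t₀) ^ 2)) t₁ := by
        refine ((hasDerivAt_const t₁ c).fun_div ((hasDerivAt_id' t₁).sub_const t₀)
          hs0.ne').congr_deriv ?_
        simp [neg_div]
      exact h3.add_const (A * R ^ 2 / (R ^ 2 - ‖y - x‖ ^ 2) ^ 2)
    have h3 := (h1.sub h2).nonneg_of_eventually_left_le ?_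
    · linarith
    · filter_upwards [Ioo_mem_nhdsLT hs1] with r hr
      have : (r, y) ∈ K := ⟨⟨⟨by linarith [hr.1], by linarith [hr.2]⟩, hyR⟩, hr.1.le, hyε⟩
      exact hmax this
  -- the space derivatives at the maximum
  have hspace : ∀ i : Fin n, dirDeriv (spaceDir i) H (t₁, y)
        = 4 * (A * R ^ 2) * (y i - x i) / (R ^ 2 - ‖y - x‖ ^ 2) ^ 3 ∧
      dirDeriv (spaceDir i) (dirDeriv (spaceDir i) H) (t₁, y)
        ≤ 4 * (A * R ^ 2) / (R ^ 2 - ‖y - x‖ ^ 2) ^ 3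
          + 24 * (A * R ^ 2) * (y i - x i) ^ 2 / (R ^ 2 - ‖y - x‖ ^ 2) ^ 4 := by
    intro i
    have hBl : ∀ r : ℝ, B ((t₁, y) + r • spaceDir i) = c / (t₁ - t₀)
        + A * R ^ 2 / (R ^ 2 - ‖y - x‖ ^ 2 - 2 * r * (y i - x i) - r ^ 2) ^ 2 := by
      intro r
      simp only [hB, Prod.fst_add, Prod.snd_add, Prod.smul_fst, Prod.smul_snd,
        norm_add_smul_single_sub_sq, smul_zero, add_zero]
      congr 3
      ring
    have hev : ∀ᶠ r : ℝ in 𝓝 0,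
        ε < R ^ 2 - ‖y - x‖ ^ 2 - 2 * r * (y i - x i) - r ^ 2 := by
      have hcont : Continuous fun r : ℝ =>
        R ^ 2 - ‖y - x‖ ^ 2 - 2 * r * (y i - x i) - r ^ 2 := by fun_prop
      refine hcont.continuousAt.eventually_const_lt ?_
      simp; linarith
    have hlineΩ : ∀ r : ℝ, (t₁, y) + r • spaceDir i ∈
        {p : ℝ × EuclideanSpace ℝ (Fin n) | 0 < p.1} := by
      intro r; simpa using hqΩ
    have hloc : IsLocalMax (fun r : ℝ => H ((t₁, y) + r • spaceDir i)
        - B ((t₁, y) + r • spaceDir i)) 0 := by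
      filter_upwards [hev] with r hr
      have hn2 := norm_add_smul_single_sub_sq y x i r
      have hmem : (t₁, y) + r • spaceDir i ∈ K := by
        have h1 : ‖y + r • EuclideanSpace.single i (1 : ℝ) - x‖ ^ 2 ≤ R ^ 2 - ε := by
          rw [hn2]; linarith
        refine ⟨⟨by simpa using ⟨ht₁0, ht₁t⟩, ?_⟩, by simpa using ht₁δ, by simpa using h1⟩
        have h2 : ‖y + r • EuclideanSpace.single i (1 : ℝ) - x‖ ≤ R :=
          le_of_sq_le_sq (by linarith) hR.le
        simpa [dist_eq_norm] using h2
      simpa using hmax hmem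
    have h1 : ∀ᶠ r : ℝ in 𝓝 0, HasDerivAt (fun r : ℝ => H ((t₁, y) + r • spaceDir i)
        - B ((t₁, y) + r • spaceDir i))
        (dirDeriv (spaceDir i) H ((t₁, y) + r • spaceDir i) - 4 * (A * R ^ 2) * (y i - x i + r)
          / (R ^ 2 - ‖y - x‖ ^ 2 - 2 * r * (y i - x i) - r ^ 2) ^ 3) r := by
      filter_upwards [hev] with r hr
      simp only [hBl]
      exact (hasDerivAt_dirDeriv_line r (hd _ (hlineΩ r))).sub
        ((hasDerivAt_barrier _ _ _ (by linarith)).const_add _)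
    have h2 : HasDerivAt (fun r : ℝ => dirDeriv (spaceDir i) H ((t₁, y) + r • spaceDir i)
        - 4 * (A * R ^ 2) * (y i - x i + r)
          / (R ^ 2 - ‖y - x‖ ^ 2 - 2 * r * (y i - x i) - r ^ 2) ^ 3)
        (dirDeriv (spaceDir i) (dirDeriv (spaceDir i) H) ((t₁, y) + (0 : ℝ) • spaceDir i)
          - (4 * (A * R ^ 2) / (R ^ 2 - ‖y - x‖ ^ 2) ^ 3
          + 24 * (A * R ^ 2) * (y i - x i) ^ 2 / (R ^ 2 - ‖y - x‖ ^ 2) ^ 4)) 0 :=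
      (hasDerivAt_dirDeriv_line 0 ((dirDeriv_contDiffOn hΩ hHs _).differentiableAt_of_mem_isOpen
        hΩ (hlineΩ 0))).sub (hasDerivAt_deriv_barrier _ _ hD0.ne')
    obtain ⟨h3, h4⟩ := hloc.eq_zero_and_nonpos_of_hasDerivAt h1 h2
    simp only [zero_smul, add_zero, mul_zero, zero_mul, sub_zero, ne_eq, OfNat.ofNat_ne_zero,
      not_false_eq_true, zero_pow] at h3 h4
    exact ⟨by linarith, by linarith⟩
  refine liYau_barrier_absurd (ι := Fin n) (α := α) (c := c) (s := t₁ - t₀) (A := A) (R := R)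
    (D := R ^ 2 - ‖y - x‖ ^ 2) (H := H (t₁, y)) (z := fun i => y i - x i)
    (a := fun i => dirDeriv (spaceDir i) f (t₁, y))
    (L := ∑ i, dirDeriv (spaceDir i) (dirDeriv (spaceDir i) f) (t₁, y))
    hα hc (by simpa using hcα) hs0 hR (by simpa using hA) ?_ hD0 ?_ hHB hHt
    (fun i => (hspace i).1) (fun i => (hspace i).2) (liYau_bochner hΩ hf heq α hqΩ)
    sq_sum_dirDeriv_le
  · rw [EuclideanSpace.norm_sq_eq]
    simp
  · simp only [hHdef, liYau]
    rw [heq _ hqΩ]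

/-- The Li–Yau inequality `|∇f|² - ∂ₜf ≤ n / (2t)` for entire solutions of `∂ₜf = Δf + |∇f|²`. -/
theorem liYau_logHeat {n : ℕ} (hn : 1 ≤ n) {f : ℝ × EuclideanSpace ℝ (Fin n) → ℝ}
    (hf : ContDiffOn ℝ ∞ f {p | 0 < p.1})
    (heq : ∀ p ∈ {p : ℝ × EuclideanSpace ℝ (Fin n) | 0 < p.1}, dirDeriv (timeDir n) f p =
      ∑ i, dirDeriv (spaceDir i) (dirDeriv (spaceDir i) f) p + ∑ i, dirDeriv (spaceDir i) f p ^ 2)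
    {t : ℝ} (ht : 0 < t) (x : EuclideanSpace ℝ (Fin n)) :
    ∑ i, dirDeriv (spaceDir i) f (t, x) ^ 2 - dirDeriv (timeDir n) f (t, x) ≤ n / (2 * t) := by
  have h1 : ∀ α : ℝ, 1 < α → ∀ t₀ : ℝ, 0 < t₀ → t₀ < t →
      liYau spaceDir (timeDir n) α f (t, x) ≤ n * α ^ 2 / 2 / (t - t₀) := by
    intro α hα t₀ ht₀ htt
    set c : ℝ := n * α ^ 2 / 2 with hc
    set A : ℝ := c * (4 * n + 24 + 8 * c / (α - 1)) with hA
    have hlim : Tendsto (fun R : ℝ => c / (t - t₀) + A / R ^ 2) atTop (𝓝 (c / (t - t₀) + 0)) :=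
      tendsto_const_nhds.add (tendsto_const_nhds.div_atTop (tendsto_pow_atTop two_ne_zero))
    rw [add_zero] at hlim
    refine ge_of_tendsto hlim ?_
    filter_upwards [eventually_gt_atTop 0] with R hR
    exact liYau_local hn hf heq hα (by rw [hc]; ring) hA ht₀ htt hR x
  have h2 : ∀ α : ℝ, 1 < α →
      liYau spaceDir (timeDir n) α f (t, x) ≤ n * α ^ 2 / 2 / t := by
    intro α hα
    have hlim : Tendsto (fun t₀ : ℝ => n * α ^ 2 / 2 / (t - t₀)) (𝓝[>] 0)
        (𝓝 (n * α ^ 2 / 2 / (t - 0))) := by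
      refine Tendsto.mono_left ?_ nhdsWithin_le_nhds
      exact tendsto_const_nhds.div (tendsto_const_nhds.sub tendsto_id) (by simpa using ht.ne')
    rw [sub_zero] at hlim
    refine ge_of_tendsto hlim ?_
    filter_upwards [Ioo_mem_nhdsGT ht] with t₀ h using h1 α hα t₀ h.1 h.2
  have hl : Tendsto (fun α : ℝ => ∑ i, dirDeriv (spaceDir i) f (t, x) ^ 2
      - α * dirDeriv (timeDir n) f (t, x)) (𝓝[>] 1)
      (𝓝 (∑ i, dirDeriv (spaceDir i) f (t, x) ^ 2 - 1 * dirDeriv (timeDir n) f (t, x))) :=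
    Tendsto.mono_left (tendsto_const_nhds.sub (tendsto_id.mul_const _)) nhdsWithin_le_nhds
  have hr : Tendsto (fun α : ℝ => n * α ^ 2 / 2 / t) (𝓝[>] 1) (𝓝 (n * 1 ^ 2 / 2 / t)) :=
    Tendsto.mono_left ((((tendsto_id.pow 2).const_mul _).div_const 2).div_const t)
      nhdsWithin_le_nhds
  have h3 := le_of_tendsto_of_tendsto hl hr
    (eventually_mem_nhdsWithin.mono fun α hα => h2 α hα)
  rw [one_mul, one_pow, mul_one, div_div] at h3
  exact h3

section Logarithm

variable {E : Type*} [NormedAddCommGroup E] [NormedSpace ℝ E] {Ω : Set E} {U : E → ℝ}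

theorem dirDeriv_log {p : E} (hU : DifferentiableAt ℝ U p) (hpos : 0 < U p) (v : E) :
    dirDeriv v (fun q => Real.log (U q)) p = dirDeriv v U p / U p := by
  simp [dirDeriv, (hU.hasFDerivAt.log hpos.ne').fderiv, div_eq_inv_mul]

theorem dirDeriv_dirDeriv_log (hΩ : IsOpen Ω) (hU : ContDiffOn ℝ ∞ U Ω) (hpos : ∀ p ∈ Ω, 0 < U p)
    {p : E} (hp : p ∈ Ω) (v : E) :
    dirDeriv v (dirDeriv v fun q => Real.log (U q)) p
      = dirDeriv v (dirDeriv v U) p / U p - (dirDeriv v U p / U p) ^ 2 := by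
  have hd := hU.differentiableAt_of_mem_isOpen hΩ hp
  have hdv := (dirDeriv_contDiffOn hΩ hU v).differentiableAt_of_mem_isOpen hΩ hp
  have hne := (hpos p hp).ne'
  rw [dirDeriv_congr hΩ (fun q hq => dirDeriv_log (hU.differentiableAt_of_mem_isOpen hΩ hq)
    (hpos q hq) v) hp]
  have hinv : HasFDerivAt (fun q => (U q)⁻¹) (-(U p ^ 2)⁻¹ • fderiv ℝ U p) p :=
    (hasDerivAt_inv hne).comp_hasFDerivAt p hd.hasFDerivAt
  simp only [div_eq_mul_inv]
  rw [dirDeriv_mul hdv hinv.differentiableAt]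
  simp only [dirDeriv, hinv.fderiv, smul_apply, smul_eq_mul]
  field_simp
  ring

end Logarithm

section Slices

variable {n : ℕ} {g : ℝ × EuclideanSpace ℝ (Fin n) → ℝ} {t : ℝ} {x : EuclideanSpace ℝ (Fin n)}

theorem fderiv_spaceSlice (hg : DifferentiableAt ℝ g (t, x)) (v : EuclideanSpace ℝ (Fin n)) :
    fderiv ℝ (fun y => g (t, y)) x v = dirDeriv (0, v) g (t, x) := by
  have h : HasFDerivAt (fun y => g (t, y)) _ x :=
    hg.hasFDerivAt.comp x ((hasFDerivAt_const t x).prodMk (hasFDerivAt_id x))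
  rw [h.fderiv]
  simp [dirDeriv]

theorem deriv_timeSlice (hg : DifferentiableAt ℝ g (t, x)) :
    deriv (fun s => g (s, x)) t = dirDeriv (timeDir n) g (t, x) := by
  have hl : HasDerivAt (fun r : ℝ => (r, x)) (timeDir n) t :=
    (hasDerivAt_id t).prodMk (hasDerivAt_const t x)
  exact (hg.hasFDerivAt.comp_hasDerivAt t hl).deriv

theorem hess_spaceSlice (hg : ContDiffOn ℝ ∞ g {p | 0 < p.1}) (ht : 0 < t)
    (v : EuclideanSpace ℝ (Fin n)) :
    hess n (fun y => g (t, y)) x v v = dirDeriv (0, v) (dirDeriv (0, v) g) (t, x) := by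
  have hΩ := isOpen_positiveTime (EuclideanSpace ℝ (Fin n))
  have h1 : (fun y => fderiv ℝ (fun z => g (t, z)) y v) = fun y => dirDeriv (0, v) g (t, y) :=
    funext fun y => fderiv_spaceSlice (hg.differentiableAt_of_mem_isOpen hΩ ht) v
  rw [hess, h1]
  exact fderiv_spaceSlice
    ((dirDeriv_contDiffOn hΩ hg _).differentiableAt_of_mem_isOpen hΩ ht) v

end Slices

theorem norm_gradient_sq_eq_sum {n : ℕ} (f : EuclideanSpace ℝ (Fin n) → ℝ)
    (x : EuclideanSpace ℝ (Fin n)) :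
    ‖gradient f x‖ ^ 2 = ∑ i, fderiv ℝ f x (EuclideanSpace.single i 1) ^ 2 := by
  rw [EuclideanSpace.norm_sq_eq]
  refine Finset.sum_congr rfl fun i _ => ?_
  rw [← inner_gradient_left, EuclideanSpace.inner_single_right]
  simp

/-- On Euclidean space `CD(0, m)` with `m > n` forces the potential to be constant, because
`exp (-φ / (m - n))` is then positive and concave. -/
theorem CDcond.gradient_eq_zero {n : ℕ} {m : ℝ} (hm : (n : ℝ) < m)
    {φ : EuclideanSpace ℝ (Fin n) → ℝ} (hφ : ContDiff ℝ ∞ φ) (hCD : CDcond n φ m 0)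
    (x : EuclideanSpace ℝ (Fin n)) : gradient φ x = 0 := by
  refine ext_inner_right ℝ fun v => ?_
  rw [inner_gradient_left, inner_zero_left]
  have hφ' : ContDiff ℝ ∞ (dirDeriv v φ) :=
    contDiffOn_univ.1 (dirDeriv_contDiffOn isOpen_univ hφ.contDiffOn v)
  have h := eq_zero_of_riccati_le (sub_pos.2 hm)
    (fun s => hasDerivAt_dirDeriv_line (p := x) (v := v) s (hφ.differentiable (by simp) _))
    (fun s => hasDerivAt_dirDeriv_line (p := x) (v := v) s (hφ'.differentiable (by simp) _))
    (fun s => by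
      have := hCD (x + s • v) v
      rw [inner_gradient_left] at this
      simp only [neg_zero, zero_mul, ge_iff_le, sub_nonneg] at this
      exact this) 0
  simpa [dirDeriv] using h

/-- **Li–Yau differential Harnack inequality** for the Witten Laplacian on `ℝⁿ`
under the `CD(0, m)` condition (Euclidean case of the `K = 0` case of Theorem 2.1). -/
theorem liYau_harnack_witten
    (n : ℕ) (hn : 1 ≤ n) (m : ℝ) (hm : (n : ℝ) < m)
    (φ : EuclideanSpace ℝ (Fin n) → ℝ) (hφ : ContDiff ℝ (⊤ : ℕ∞) φ)
    (hCD : CDcond n φ m 0)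
    (u : ℝ → EuclideanSpace ℝ (Fin n) → ℝ)
    (hu : ContDiffOn ℝ (⊤ : ℕ∞) (fun p : ℝ × EuclideanSpace ℝ (Fin n) => u p.1 p.2)
      {p : ℝ × EuclideanSpace ℝ (Fin n) | 0 < p.1})
    (hpos : ∀ t > (0 : ℝ), ∀ x, 0 < u t x)
    (hheat : ∀ t > (0 : ℝ), ∀ x, deriv (fun s => u s x) t = witten n φ (u t) x) :
    ∀ t > (0 : ℝ), ∀ x,
      ‖gradient (u t) x‖ ^ 2 / (u t x) ^ 2 - deriv (fun s => u s x) t / u t x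
        ≤ m / (2 * t) := by
  intro t ht x
  set U : ℝ × EuclideanSpace ℝ (Fin n) → ℝ := fun p => u p.1 p.2 with hU
  have hΩ := isOpen_positiveTime (EuclideanSpace ℝ (Fin n))
  have hposU : ∀ p ∈ {p : ℝ × EuclideanSpace ℝ (Fin n) | 0 < p.1}, 0 < U p :=
    fun p hp => hpos p.1 hp p.2
  have hd : ∀ p ∈ {p : ℝ × EuclideanSpace ℝ (Fin n) | 0 < p.1}, DifferentiableAt ℝ U p :=
    fun p hp => hu.differentiableAt_of_mem_isOpen hΩ hp
  have hheatU : ∀ p ∈ {p : ℝ × EuclideanSpace ℝ (Fin n) | 0 < p.1}, dirDeriv (timeDir n) U p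
      = ∑ i, dirDeriv (spaceDir i) (dirDeriv (spaceDir i) U) p := by
    rintro ⟨s, y⟩ hs
    have h := hheat s hs y
    rw [witten, hCD.gradient_eq_zero hm hφ, inner_zero_left, sub_zero, lap] at h
    rw [← deriv_timeSlice (hd _ hs)]
    refine h.trans (Finset.sum_congr rfl fun i _ => ?_)
    exact hess_spaceSlice hu hs _
  have hf : ContDiffOn ℝ ∞ (fun p => Real.log (U p)) {p | 0 < p.1} :=
    hu.log fun p hp => (hposU p hp).ne'
  have hmem : (t, x) ∈ {p : ℝ × EuclideanSpace ℝ (Fin n) | 0 < p.1} := ht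
  have key := liYau_logHeat hn hf (fun p hp => by
    rw [dirDeriv_log (hd p hp) (hposU p hp), hheatU p hp, Finset.sum_div,
      ← Finset.sum_add_distrib]
    refine Finset.sum_congr rfl fun i _ => ?_
    rw [dirDeriv_dirDeriv_log hΩ hu hposU hp, dirDeriv_log (hd p hp) (hposU p hp)]
    ring) ht x
  simp only [dirDeriv_log (hd _ hmem) (hposU _ hmem), div_pow, ← Finset.sum_div] at key
  have hgrad : ‖gradient (u t) x‖ ^ 2 = ∑ i, dirDeriv (spaceDir i) U (t, x) ^ 2 := by
    rw [norm_gradient_sq_eq_sum]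
    exact Finset.sum_congr rfl fun i _ =>
      congrArg (· ^ 2) (fderiv_spaceSlice (hd _ hmem) (EuclideanSpace.single i 1))
  rw [hgrad, show deriv (fun s => u s x) t = _ from deriv_timeSlice (hd _ hmem)]
  exact key.trans (by gcongr)
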